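/- arXiv:1806.01959 — 2 statements merged into one kernel-verified Lean document; each statement's English description precedes it below -/
import Mathlib

section
/- For every s ∈ ℂ with Re(s) > 0, the trigamma function has the integral representation ψ'(s) = ∫₁^∞ (log x)/(x − 1) · x^{−s} dx, where x^{−s} = exp(−s log x) for real x > 1 and the integrand is extended continuously by the value 1·x^{-s} at x = 1. -/
open Complex MeasureTheory

/-- The trigamma function `ψ'`, the derivative of the digamma function
`ψ = Γ'/Γ` (the logarithmic derivative of the complex Gamma function). -/
noncomputable def trigamma (s : ℂ) : ℂ :=
  deriv (fun z : ℂ => deriv Complex.Gamma z / Complex.Gamma z) s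

open Filter Topology

/-- A pointwise limit of holomorphic functions bounded uniformly near `z`: the derivatives
converge at `z`. -/
theorem tendsto_deriv_of_eventually_bounded {F : ℕ → ℂ → ℂ} {f : ℂ → ℂ} {U : Set ℂ}
    (hU : IsOpen U) (hF : ∀ n, DifferentiableOn ℂ (F n) U) (hf : DifferentiableOn ℂ f U)
    (hlim : ∀ z ∈ U, Tendsto (fun n ↦ F n z) atTop (𝓝 (f z))) {z : ℂ} (hz : z ∈ U) {C : ℝ}
    (hC : ∀ᶠ w in 𝓝 z, ∀ n, ‖F n w‖ ≤ C) :
    Tendsto (fun n ↦ deriv (F n) z) atTop (𝓝 (deriv f z)) := by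
  obtain ⟨r, hr, hball⟩ := Metric.nhds_basis_closedBall.eventually_iff.1
    ((hU.eventually_mem hz).and hC)
  have hsub : Metric.closedBall z r ⊆ U := fun w hw ↦ (hball hw).1
  have key : ∀ g : ℂ → ℂ, DifferentiableOn ℂ g U →
      deriv g z = (2 * Real.pi * I : ℂ)⁻¹ • ∮ w in C(z, r), (1 / (w - z) ^ 2) • g w := by
    intro g hg
    rw [(hg.mono hsub).deriv_eq_smul_circleIntegral hr, smul_smul,
      inv_mul_cancel₀ two_pi_I_ne_zero, one_smul]
  rw [key f hf]
  simp_rw [fun n ↦ key (F n) (hF n)]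
  refine Tendsto.const_smul ?_ _
  have hmem : ∀ θ, circleMap z r θ ∈ Metric.closedBall z r :=
    fun θ ↦ circleMap_mem_closedBall z hr.le θ
  refine intervalIntegral.tendsto_integral_filter_of_dominated_convergence
    (fun _ ↦ r * (1 / r ^ 2 * C)) (Eventually.of_forall fun n ↦ ?_)
    (Eventually.of_forall fun n ↦ ae_of_all _ fun θ _ ↦ ?_) (by simp)
    (ae_of_all _ fun θ _ ↦ ?_)
  · refine Continuous.aestronglyMeasurable ?_
    have h1 : Continuous fun θ ↦ F n (circleMap z r θ) :=
      ((hF n).continuousOn.comp_continuous (continuous_circleMap z r) fun θ ↦ hsub (hmem θ))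
    have h2 : Continuous fun θ ↦ 1 / (circleMap z r θ - z) ^ 2 := by
      refine continuous_const.div (by fun_prop) fun θ ↦ ?_
      exact pow_ne_zero _ (sub_ne_zero.2 (circleMap_ne_center hr.ne'))
    simp only [deriv_circleMap]
    exact Continuous.smul ((continuous_circleMap 0 r).mul continuous_const) (h2.smul h1)
  · have := (hball (hmem θ)).2 n
    simp only [deriv_circleMap, norm_smul, norm_mul, norm_circleMap_zero, norm_I, mul_one, norm_div,
      norm_one, norm_pow, circleMap_sub_center, abs_of_pos hr]
    gcongr
  · exact ((hlim _ (hsub (hmem θ))).const_smul _).const_smul _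

/-- Uniform local bounds pass to derivatives of holomorphic functions. -/
theorem eventually_bounded_deriv {F : ℕ → ℂ → ℂ} {U : Set ℂ} (hU : IsOpen U)
    (hF : ∀ n, DifferentiableOn ℂ (F n) U) {z : ℂ} (hz : z ∈ U) {C : ℝ}
    (hC : ∀ᶠ w in 𝓝 z, ∀ n, ‖F n w‖ ≤ C) :
    ∃ C', ∀ᶠ w in 𝓝 z, ∀ n, ‖deriv (F n) w‖ ≤ C' := by
  obtain ⟨r, hr, hball⟩ := Metric.nhds_basis_closedBall.eventually_iff.1
    ((hU.eventually_mem hz).and hC)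
  refine ⟨C / (r / 2), ?_⟩
  filter_upwards [Metric.closedBall_mem_nhds z (half_pos hr)] with w hw n
  have hsub : Metric.closedBall w (r / 2) ⊆ Metric.closedBall z r :=
    Metric.closedBall_subset_closedBall' (by rw [Metric.mem_closedBall] at hw; linarith)
  refine norm_deriv_le_of_forall_mem_sphere_norm_le (half_pos hr) ?_ fun v hv ↦
    (hball (hsub (Metric.sphere_subset_closedBall hv))).2 n
  refine DifferentiableOn.diffContOnCl ((hF n).mono fun v hv ↦ ?_)
  exact (hball (hsub (Metric.closure_ball_subset_closedBall hv))).1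

theorem norm_GammaSeq_le {s : ℂ} (hs : 0 < s.re) {n : ℕ} (hn : n ≠ 0) :
    ‖GammaSeq s n‖ ≤ Real.Gamma s.re := by
  have hint := Real.GammaIntegral_convergent hs
  rw [GammaSeq_eq_approx_Gamma_integral hs hn, Real.Gamma_eq_integral hs,
    intervalIntegral.integral_of_le (by positivity)]
  calc _ ≤ ∫ x in Set.Ioc 0 (n : ℝ), Real.exp (-x) * x ^ (s.re - 1) := by
        refine norm_integral_le_of_norm_le (hint.mono_set Set.Ioc_subset_Ioi_self) ?_
        refine (ae_restrict_iff' measurableSet_Ioc).2 (ae_of_all _ fun x hx ↦ ?_)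
        have h0 : 0 ≤ 1 - x / n := by
          rw [sub_nonneg]
          exact div_le_one_of_le₀ hx.2 (by positivity)
        rw [norm_mul, norm_cpow_eq_rpow_re_of_pos hx.1, norm_real,
          Real.norm_of_nonneg (pow_nonneg h0 n), sub_re, one_re]
        have := Real.rpow_nonneg hx.1.le (s.re - 1)
        gcongr
        exact Real.one_sub_div_pow_le_exp_neg hx.2
    _ ≤ _ := by
        refine setIntegral_mono_set hint ?_ Set.Ioc_subset_Ioi_self.eventuallyLE
        refine (ae_restrict_iff' measurableSet_Ioi).2 (ae_of_all _ fun x hx ↦ ?_)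
        exact mul_nonneg (Real.exp_pos _).le (Real.rpow_nonneg (le_of_lt hx) _)

theorem add_natCast_ne_zero_of_re_pos {s : ℂ} (hs : 0 < s.re) (j : ℕ) : s + j ≠ 0 := by
  intro h
  have := congrArg re h
  simp only [add_re, natCast_re, zero_re] at this
  have : (0 : ℝ) ≤ j := by positivity
  linarith

theorem prod_add_natCast_ne_zero {s : ℂ} (hs : 0 < s.re) (n : ℕ) :
    ∏ j ∈ Finset.range n, (s + j) ≠ 0 :=
  Finset.prod_ne_zero_iff.2 fun j _ ↦ add_natCast_ne_zero_of_re_pos hs j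

theorem GammaSeq_ne_zero {s : ℂ} (hs : 0 < s.re) {n : ℕ} (hn : n ≠ 0) : GammaSeq s n ≠ 0 := by
  have hn' : (n : ℂ) ≠ 0 := Nat.cast_ne_zero.2 hn
  refine div_ne_zero (mul_ne_zero ?_ (Nat.cast_ne_zero.2 n.factorial_ne_zero))
    (prod_add_natCast_ne_zero hs _)
  exact (cpow_ne_zero_iff_of_exponent_ne_zero (by rintro rfl; simp at hs)).2 hn'

theorem differentiableAt_GammaSeq {s : ℂ} (hs : 0 < s.re) {n : ℕ} (hn : n ≠ 0) :
    DifferentiableAt ℂ (fun z ↦ GammaSeq z n) s := by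
  have hn' : (n : ℂ) ≠ 0 := Nat.cast_ne_zero.2 hn
  refine DifferentiableAt.fun_div ((differentiableAt_id.const_cpow (Or.inl hn')).mul_const _) ?_
    (prod_add_natCast_ne_zero hs _)
  fun_prop

theorem logDeriv_GammaSeq {s : ℂ} (hs : 0 < s.re) {n : ℕ} (hn : n ≠ 0) :
    logDeriv (fun z ↦ GammaSeq z n) s
      = Complex.log n - ∑ j ∈ Finset.range (n + 1), (s + j)⁻¹ := by
  have hn' : (n : ℂ) ≠ 0 := Nat.cast_ne_zero.2 hn
  have hs0 : s ≠ 0 := by rintro rfl; simp at hs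
  have hpow : (n : ℂ) ^ s ≠ 0 := (cpow_ne_zero_iff_of_exponent_ne_zero hs0).2 hn'
  have hfac : (n.factorial : ℂ) ≠ 0 := Nat.cast_ne_zero.2 n.factorial_ne_zero
  have hd : HasDerivAt (fun z : ℂ ↦ (n : ℂ) ^ z) ((n : ℂ) ^ s * Complex.log n) s := by
    simpa using (hasDerivAt_id s).const_cpow (Or.inl hn')
  have hprod := logDeriv_prod (s := Finset.range (n + 1)) (f := fun j (z : ℂ) ↦ z + (j : ℂ))
    (x := s) (fun j _ ↦ add_natCast_ne_zero_of_re_pos hs j) (fun j _ ↦ by fun_prop)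
  unfold GammaSeq
  rw [logDeriv_div (f := fun z ↦ (n : ℂ) ^ z * n.factorial) s (mul_ne_zero hpow hfac)
    (prod_add_natCast_ne_zero hs _)
    (hd.differentiableAt.mul_const _) (by fun_prop), logDeriv_mul_const _ _ hfac,
    logDeriv_apply, hd.deriv, mul_div_cancel_left₀ _ hpow, hprod]
  simp [logDeriv_apply]

theorem deriv_logDeriv_GammaSeq {s : ℂ} (hs : 0 < s.re) {n : ℕ} (hn : n ≠ 0) :
    deriv (logDeriv fun z ↦ GammaSeq z n) s
      = ∑ j ∈ Finset.range (n + 1), 1 / (s + j) ^ 2 := by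
  have hU : ∀ᶠ z : ℂ in 𝓝 s, 0 < z.re := continuous_re.continuousAt.eventually_const_lt hs
  have : (logDeriv fun z ↦ GammaSeq z n) =ᶠ[𝓝 s]
      fun z ↦ Complex.log n - ∑ j ∈ Finset.range (n + 1), (z + j)⁻¹ :=
    hU.mono fun z hz ↦ logDeriv_GammaSeq hz hn
  rw [this.deriv_eq]
  have hsum : HasDerivAt (fun z : ℂ ↦ ∑ j ∈ Finset.range (n + 1), (z + j)⁻¹)
      (∑ j ∈ Finset.range (n + 1), -1 / (s + j) ^ 2) s :=
    HasDerivAt.fun_sum fun j _ ↦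
      ((hasDerivAt_id s).add_const (j : ℂ)).fun_inv (add_natCast_ne_zero_of_re_pos hs j)
  rw [(hsum.const_sub _).deriv, ← Finset.sum_neg_distrib]
  exact Finset.sum_congr rfl fun j _ ↦ by ring

theorem deriv_logDeriv {f : ℂ → ℂ} {s : ℂ} (hf : DifferentiableAt ℂ f s)
    (hf' : DifferentiableAt ℂ (deriv f) s) (h0 : f s ≠ 0) :
    deriv (logDeriv f) s = (deriv (deriv f) s * f s - deriv f s * deriv f s) / f s ^ 2 :=
  deriv_div hf' hf h0

theorem tendsto_sum_trigamma {s : ℂ} (hs : 0 < s.re) :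
    Tendsto (fun n : ℕ ↦ ∑ j ∈ Finset.range (n + 2), 1 / (s + j) ^ 2) atTop
      (𝓝 (trigamma s)) := by
  set U : Set ℂ := {z | 0 < z.re}
  have hU : IsOpen U := isOpen_lt continuous_const continuous_re
  set F : ℕ → ℂ → ℂ := fun n z ↦ GammaSeq z (n + 1)
  have hF : ∀ n, DifferentiableOn ℂ (F n) U := fun n z hz ↦
    (differentiableAt_GammaSeq hz n.succ_ne_zero).differentiableWithinAt
  have hΓ : DifferentiableOn ℂ Complex.Gamma U := fun z hz ↦
    (differentiableAt_Gamma z fun m h ↦ add_natCast_ne_zero_of_re_pos hz m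
      (by rw [h, neg_add_cancel])).differentiableWithinAt
  have hlim : ∀ z ∈ U, Tendsto (fun n ↦ F n z) atTop (𝓝 (Complex.Gamma z)) := fun z _ ↦
    (GammaSeq_tendsto_Gamma z).comp (tendsto_add_atTop_nat 1)
  have hbd : ∀ z ∈ U, ∃ C, ∀ᶠ w in 𝓝 z, ∀ n, ‖F n w‖ ≤ C := by
    intro z hz
    refine ⟨Real.Gamma z.re + 1, ?_⟩
    have hc : ContinuousAt (fun w : ℂ ↦ Real.Gamma w.re) z :=
      ContinuousAt.comp (g := Real.Gamma)
        ((Real.differentiableOn_Gamma_Ioi.differentiableAt (Ioi_mem_nhds hz)).continuousAt)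
        continuous_re.continuousAt
    filter_upwards [hU.mem_nhds hz, hc.eventually_lt_const (lt_add_one _)] with w hw hlt n
    exact (norm_GammaSeq_le hw n.succ_ne_zero).trans hlt.le
  have hlim' : ∀ z ∈ U, Tendsto (fun n ↦ deriv (F n) z) atTop (𝓝 (deriv Complex.Gamma z)) := by
    intro z hz
    obtain ⟨C, hC⟩ := hbd z hz
    exact tendsto_deriv_of_eventually_bounded hU hF hΓ hlim hz hC
  have hlim'' : Tendsto (fun n ↦ deriv (deriv (F n)) s) atTop
      (𝓝 (deriv (deriv Complex.Gamma) s)) := by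
    obtain ⟨C, hC⟩ := hbd s hs
    obtain ⟨C', hC'⟩ := eventually_bounded_deriv hU hF hs hC
    exact tendsto_deriv_of_eventually_bounded hU (fun n ↦ (hF n).deriv hU) (hΓ.deriv hU)
      hlim' hs hC'
  have hsU : U ∈ 𝓝 s := hU.mem_nhds hs
  have h0 : Complex.Gamma s ≠ 0 := Gamma_ne_zero_of_re_pos hs
  have htri : trigamma s = deriv (logDeriv Complex.Gamma) s := rfl
  rw [htri, deriv_logDeriv (hΓ.differentiableAt hsU) ((hΓ.deriv hU).differentiableAt hsU) h0]
  refine (((hlim''.mul (hlim s hs)).sub ((hlim' s hs).mul (hlim' s hs))).div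
    ((hlim s hs).pow 2) (pow_ne_zero 2 h0)).congr fun n ↦ ?_
  rw [← deriv_logDeriv_GammaSeq hs n.succ_ne_zero,
    deriv_logDeriv ((hF n).differentiableAt hsU) (((hF n).deriv hU).differentiableAt hsU)
      (GammaSeq_ne_zero hs n.succ_ne_zero)]
  rfl

theorem hasDerivAt_log_mul_cpow {s : ℂ} (hs : s ≠ 0) {x : ℝ} (hx : 0 < x) :
    HasDerivAt (fun x : ℝ ↦ -((Real.log x / s + 1 / s ^ 2) * (x : ℂ) ^ (-s)))
      (Real.log x * (x : ℂ) ^ (-s - 1)) x := by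
  have hx' : (x : ℂ) ≠ 0 := ofReal_ne_zero.2 hx.ne'
  have h1 : HasDerivAt (fun x : ℝ ↦ ((Real.log x : ℝ) : ℂ)) ((x⁻¹ : ℝ) : ℂ) x :=
    (Real.hasDerivAt_log hx.ne').ofReal_comp
  have h2 : HasDerivAt (fun x : ℝ ↦ (x : ℂ) ^ (-s)) (-s * (x : ℂ) ^ (-s - 1)) x := by
    simpa using ((hasDerivAt_id (x : ℂ)).cpow_const (c := -s)
      (Or.inl (by simpa using hx))).comp_ofReal
  convert! (((h1.div_const s).add_const (1 / s ^ 2)).mul h2).neg using 1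
  have h3 : (x : ℂ) ^ (-s) = (x : ℂ) ^ (-s - 1) * x := by
    rw [cpow_sub _ _ hx', cpow_one, div_mul_cancel₀ _ hx']
  rw [h3]
  push_cast
  field_simp
  ring

theorem tendsto_log_mul_cpow {s : ℂ} (hs : 0 < s.re) :
    Tendsto (fun x : ℝ ↦ -((Real.log x / s + 1 / s ^ 2) * (x : ℂ) ^ (-s))) atTop (𝓝 0) := by
  have h1 : Tendsto (fun x : ℝ ↦ (x : ℂ) ^ (-s)) atTop (𝓝 0) := by
    rw [tendsto_zero_iff_norm_tendsto_zero]
    refine (tendsto_rpow_neg_atTop hs).congr' ?_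
    filter_upwards [eventually_gt_atTop 0] with x hx
    rw [norm_cpow_eq_rpow_re_of_pos hx, neg_re]
  have h2 : Tendsto (fun x : ℝ ↦ (Real.log x : ℂ) * (x : ℂ) ^ (-s)) atTop (𝓝 0) := by
    rw [tendsto_zero_iff_norm_tendsto_zero]
    refine ((isLittleO_log_rpow_atTop hs).tendsto_div_nhds_zero).congr' ?_
    filter_upwards [eventually_gt_atTop 1] with x hx
    have hx0 : 0 < x := by linarith
    rw [norm_mul, norm_cpow_eq_rpow_re_of_pos hx0, neg_re, norm_real,
      Real.norm_of_nonneg (Real.log_nonneg hx.le), Real.rpow_neg hx0.le, div_eq_mul_inv]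
  have h3 := ((h2.const_mul s⁻¹).add (h1.const_mul (1 / s ^ 2))).neg
  simp only [mul_zero, add_zero, neg_zero] at h3
  exact h3.congr fun x ↦ by ring

theorem norm_log_mul_cpow {s : ℂ} {x : ℝ} (hx : 1 < x) :
    ‖(Real.log x : ℂ) * (x : ℂ) ^ (-s - 1)‖ = Real.log x * x ^ (-s.re - 1) := by
  rw [norm_mul, norm_cpow_eq_rpow_re_of_pos (by linarith), norm_real,
    Real.norm_of_nonneg (Real.log_nonneg hx.le)]
  simp

theorem integrableOn_log_mul_rpow {a : ℝ} (ha : 0 < a) :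
    IntegrableOn (fun x : ℝ ↦ Real.log x * x ^ (-a - 1)) (Set.Ioi 1) := by
  have hofReal : ∀ x : ℝ, 0 < x →
      ((Real.log x : ℂ) * (x : ℂ) ^ (-(a : ℂ) - 1)).re = Real.log x * x ^ (-a - 1) := by
    intro x hx
    rw [show (-(a : ℂ) - 1) = ((-a - 1 : ℝ) : ℂ) by push_cast; ring, ← ofReal_cpow hx.le,
      ← ofReal_mul, ofReal_re]
  have ha' : (a : ℂ) ≠ 0 := ofReal_ne_zero.2 ha.ne'
  refine integrableOn_Ioi_deriv_of_nonneg'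
    (g := fun x : ℝ ↦ (-((Real.log x / (a : ℂ) + 1 / (a : ℂ) ^ 2) * (x : ℂ) ^ (-(a : ℂ)))).re)
    (l := 0) (fun x hx ↦ ?_) (fun x hx ↦ ?_) ?_
  · have hx0 : 0 < x := lt_of_lt_of_le one_pos hx
    rw [← hofReal x hx0]
    exact reCLM.hasFDerivAt.comp_hasDerivAt x (hasDerivAt_log_mul_cpow ha' hx0)
  · have hx1 : 1 < x := hx
    exact mul_nonneg (Real.log_nonneg hx1.le) (Real.rpow_nonneg (by linarith) _)
  · have := (continuous_re.tendsto 0).comp (tendsto_log_mul_cpow (s := (a : ℂ)) (by simpa using ha))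
    rwa [zero_re] at this

theorem integrableOn_log_mul_cpow {s : ℂ} (hs : 0 < s.re) :
    IntegrableOn (fun x : ℝ ↦ (Real.log x : ℂ) * (x : ℂ) ^ (-s - 1)) (Set.Ioi 1) := by
  refine Integrable.mono' (integrableOn_log_mul_rpow hs) ?_ ?_
  · exact Measurable.aestronglyMeasurable (by fun_prop)
  · exact (ae_restrict_iff' measurableSet_Ioi).2
      (ae_of_all _ fun x hx ↦ (norm_log_mul_cpow hx).le)

theorem integral_log_mul_cpow {s : ℂ} (hs : 0 < s.re) :
    ∫ x : ℝ in Set.Ioi 1, (Real.log x : ℂ) * (x : ℂ) ^ (-s - 1) = 1 / s ^ 2 := by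
  have hs0 : s ≠ 0 := by rintro rfl; simp at hs
  rw [integral_Ioi_of_hasDerivAt_of_tendsto'
    (fun x hx ↦ hasDerivAt_log_mul_cpow hs0 (lt_of_lt_of_le one_pos hx))
    (integrableOn_log_mul_cpow hs) (tendsto_log_mul_cpow hs)]
  simp

theorem integral_log_mul_rpow {a : ℝ} (ha : 0 < a) :
    ∫ x : ℝ in Set.Ioi 1, Real.log x * x ^ (-a - 1) = 1 / a ^ 2 := by
  have h := integral_log_mul_cpow (s := (a : ℂ)) (by simpa using ha)
  rw [← ofReal_inj, ← integral_complex_ofReal]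
  push_cast
  rw [← h]
  refine setIntegral_congr_fun measurableSet_Ioi fun x hx ↦ ?_
  have hx1 : 1 < x := hx
  simp [ofReal_cpow (zero_le_one.trans hx1.le)]

theorem hasSum_log_mul_cpow (s : ℂ) {x : ℝ} (hx : 1 < x) :
    HasSum (fun n : ℕ ↦ (Real.log x : ℂ) * (x : ℂ) ^ (-(s + n) - 1))
      (((Real.log x / (x - 1) : ℝ) : ℂ) * (x : ℂ) ^ (-s)) := by
  have hx0 : (x : ℂ) ≠ 0 := ofReal_ne_zero.2 (by linarith)
  have hx1 : (x : ℂ) - 1 ≠ 0 := by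
    rw [← ofReal_one, ← ofReal_sub]
    exact ofReal_ne_zero.2 (by linarith)
  have hgeo : HasSum (fun n : ℕ ↦ ((x : ℂ)⁻¹) ^ n) (1 - (x : ℂ)⁻¹)⁻¹ := by
    refine hasSum_geometric_of_norm_lt_one ?_
    rw [norm_inv, norm_real, Real.norm_of_nonneg (by linarith)]
    exact inv_lt_one_of_one_lt₀ hx
  convert! hgeo.mul_left ((Real.log x : ℂ) * ((x : ℂ) ^ (-s) * (x : ℂ)⁻¹)) using 1
  · ext n
    rw [show -(s + n) - 1 = -s - n - 1 by ring, cpow_sub _ _ hx0, cpow_sub _ _ hx0, cpow_one,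
      cpow_natCast, inv_pow]
    ring
  · have : (1 - (x : ℂ)⁻¹)⁻¹ = x / (x - 1) := by
      rw [← inv_div]
      congr 1
      field_simp
    rw [this]
    push_cast
    field_simp

theorem summable_one_div_add_natCast_sq {a : ℝ} (ha : 0 < a) :
    Summable fun n : ℕ ↦ 1 / (a + n) ^ 2 := by
  rw [← summable_nat_add_iff 1]
  refine Summable.of_nonneg_of_le (fun n ↦ by positivity) (fun n ↦ ?_)
    ((summable_nat_add_iff 1).2 (Real.summable_one_div_nat_pow.2 one_lt_two))
  have : (0 : ℝ) < ((n + 1 : ℕ) : ℝ) := by positivity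
  gcongr
  linarith

theorem hasSum_integral_log_div {s : ℂ} (hs : 0 < s.re) :
    HasSum (fun n : ℕ ↦ 1 / (s + n) ^ 2) (∫ x : ℝ in Set.Ioi (1 : ℝ),
      ((Real.log x / (x - 1) : ℝ) : ℂ) * (x : ℂ) ^ (-s)) := by
  have hre : ∀ n : ℕ, 0 < (s + n).re := fun n ↦ by
    rw [add_re, natCast_re]
    positivity
  have hnorm : ∀ n : ℕ, ∫ x : ℝ in Set.Ioi 1, ‖(Real.log x : ℂ) * (x : ℂ) ^ (-(s + n) - 1)‖
      = 1 / (s.re + n) ^ 2 := fun n ↦ by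
    rw [setIntegral_congr_fun measurableSet_Ioi fun x hx ↦ norm_log_mul_cpow hx,
      integral_log_mul_rpow (hre n), add_re, natCast_re]
  have h := hasSum_integral_of_summable_integral_norm
    (fun n : ℕ ↦ integrableOn_log_mul_cpow (hre n))
    (by simpa only [hnorm] using summable_one_div_add_natCast_sq hs)
  simp only [fun n : ℕ ↦ integral_log_mul_cpow (hre n)] at h
  rwa [setIntegral_congr_fun measurableSet_Ioi fun x hx ↦ (hasSum_log_mul_cpow s hx).tsum_eq] at h

/-- Integral representation of the trigamma function:
`ψ'(s) = ∫₁^∞ (log x)/(x-1) · x^{-s} dx` for `Re s > 0`. -/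
theorem stmt_3 (s : ℂ) (hs : 0 < s.re) :
    trigamma s = ∫ x : ℝ in Set.Ioi (1 : ℝ),
      ((Real.log x / (x - 1) : ℝ) : ℂ) * (x : ℂ) ^ (-s) := by
  exact tendsto_nhds_unique (tendsto_sum_trigamma hs)
    ((hasSum_integral_log_div hs).tendsto_sum_nat.comp (tendsto_add_atTop_nat 2))
end

section
/- Let A ≥ 0, C > 0, and let φ : [1, ∞) → ℂ be measurable with |φ(x)| ≤ C·x^A for all x ≥ 1. Then for every s ∈ ℂ with Re(s) > A + 1, one has ∫₀^∞ (∫₁^∞ φ(x) e^{−xy} dx) y^{s−1} dy = Γ(s) · ∫₁^∞ φ(x) x^{−s} dx, all integrals converging absolutely. -/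
open Complex MeasureTheory Set

lemma integrableOn_Ioi_rpow_mul_exp_neg_mul {a r : ℝ} (ha : -1 < a) (hr : 0 < r) :
    IntegrableOn (fun t : ℝ => t ^ a * Real.exp (-(r * t))) (Ioi 0) := by
  simpa using integrableOn_rpow_mul_exp_neg_mul_rpow ha one_pos hr

lemma integrableOn_mul_cpow_neg_of_norm_le_rpow {A C : ℝ} {φ : ℝ → ℂ} (hφm : Measurable φ)
    (hφ : ∀ x : ℝ, 1 ≤ x → ‖φ x‖ ≤ C * x ^ A) {s : ℂ} (hs : A + 1 < s.re) :
    IntegrableOn (fun x : ℝ => φ x * (x : ℂ) ^ (-s)) (Ioi 1) := by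
  have hg : IntegrableOn (fun x : ℝ => C * x ^ (A - s.re)) (Ioi 1) :=
    (integrableOn_Ioi_rpow_of_lt (by linarith) one_pos).const_mul C
  refine hg.mono' (by fun_prop) ?_
  filter_upwards [ae_restrict_mem measurableSet_Ioi] with x hx
  have hx0 : 0 < x := one_pos.trans hx
  rw [norm_mul, norm_cpow_eq_rpow_re_of_pos hx0, neg_re, sub_eq_add_neg, Real.rpow_add hx0,
    ← mul_assoc]
  exact mul_le_mul_of_nonneg_right (hφ x (le_of_lt hx)) (by positivity)

lemma integrableOn_mul_exp_neg_mul_of_norm_le_rpow {A C : ℝ} (hA : 0 ≤ A) {φ : ℝ → ℂ}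
    (hφm : Measurable φ) (hφ : ∀ x : ℝ, 1 ≤ x → ‖φ x‖ ≤ C * x ^ A) {y : ℝ} (hy : 0 < y) :
    IntegrableOn (fun x : ℝ => φ x * Real.exp (-(x * y))) (Ioi 1) := by
  have hg : IntegrableOn (fun x : ℝ => C * (x ^ A * Real.exp (-(y * x)))) (Ioi 1) :=
    ((integrableOn_Ioi_rpow_mul_exp_neg_mul (by linarith) hy).mono_set
      (Ioi_subset_Ioi zero_le_one)).const_mul C
  refine hg.mono' (by fun_prop) ?_
  filter_upwards [ae_restrict_mem measurableSet_Ioi] with x hx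
  rw [norm_mul, norm_real, Real.norm_of_nonneg (Real.exp_pos _).le, ← mul_assoc, mul_comm y x]
  exact mul_le_mul_of_nonneg_right (hφ x (le_of_lt hx)) (Real.exp_pos _).le

/-- The integrand of the Mellin transform of a Laplace transform is integrable on the product
as soon as `φ x * x ^ (-s)` is integrable. -/
lemma integrable_prod_mul_exp_neg_mul_mul_cpow {φ : ℝ → ℂ} (hφm : Measurable φ) {s : ℂ}
    (hs : 0 < s.re) (hφ : IntegrableOn (fun x : ℝ => φ x * (x : ℂ) ^ (-s)) (Ioi 1)) :
    Integrable (Function.uncurry fun x y : ℝ =>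
        φ x * Real.exp (-(x * y)) * (y : ℂ) ^ (s - 1))
      ((volume.restrict (Ioi 1)).prod (volume.restrict (Ioi 0))) := by
  have hnorm : ∀ x y : ℝ, 0 < y → ‖φ x * Real.exp (-(x * y)) * (y : ℂ) ^ (s - 1)‖ =
      ‖φ x‖ * (y ^ (s.re - 1) * Real.exp (-(x * y))) := fun x y hy => by
    rw [norm_mul, norm_mul, norm_real, Real.norm_of_nonneg (Real.exp_pos _).le,
      norm_cpow_eq_rpow_re_of_pos hy, sub_re, one_re]
    ring
  rw [integrable_prod_iff]
  · constructor
    · filter_upwards [ae_restrict_mem measurableSet_Ioi] with x hx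
      have hx0 : 0 < x := one_pos.trans hx
      refine ((integrableOn_Ioi_rpow_mul_exp_neg_mul (a := s.re - 1) (by linarith)
        hx0).const_mul ‖φ x‖).mono' (by simp only [Function.uncurry_apply_pair]; fun_prop) ?_
      filter_upwards [ae_restrict_mem measurableSet_Ioi] with y hy
      exact (hnorm x y hy).le
    · refine (hφ.norm.mul_const (Real.Gamma s.re)).congr ?_
      filter_upwards [ae_restrict_mem measurableSet_Ioi] with x hx
      have hx0 : 0 < x := one_pos.trans hx
      simp only [Function.uncurry_apply_pair]
      rw [setIntegral_congr_fun measurableSet_Ioi (fun y hy => hnorm x y hy),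
        integral_const_mul, Real.integral_rpow_mul_exp_neg_mul_Ioi hs hx0, norm_mul,
        norm_cpow_eq_rpow_re_of_pos hx0, neg_re, one_div, Real.inv_rpow hx0.le,
        Real.rpow_neg hx0.le, mul_assoc]
  · apply Measurable.aestronglyMeasurable
    unfold Function.uncurry
    fun_prop

/-- Mellin transform of a Laplace transform: if `φ` is measurable on `[1,∞)` with
`|φ(x)| ≤ C x^A`, then for `Re s > A + 1`,
`∫₀^∞ (∫₁^∞ φ(x) e^{-xy} dx) y^{s-1} dy = Γ(s) ∫₁^∞ φ(x) x^{-s} dx`,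
all integrals converging absolutely. -/
theorem stmt_4 (A C : ℝ) (hA : 0 ≤ A) (hC : 0 < C) (φ : ℝ → ℂ)
    (hφm : Measurable φ) (hφ : ∀ x : ℝ, 1 ≤ x → ‖φ x‖ ≤ C * x ^ A)
    (s : ℂ) (hs : A + 1 < s.re) :
    (∀ y : ℝ, 0 < y →
        IntegrableOn (fun x : ℝ => φ x * Real.exp (-(x * y))) (Ioi 1)) ∧
    IntegrableOn
      (fun y : ℝ =>
        (∫ x : ℝ in Ioi (1 : ℝ), φ x * Real.exp (-(x * y))) * (y : ℂ) ^ (s - 1))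
      (Ioi 0) ∧
    IntegrableOn (fun x : ℝ => φ x * (x : ℂ) ^ (-s)) (Ioi 1) ∧
    ∫ y : ℝ in Ioi (0 : ℝ),
        (∫ x : ℝ in Ioi (1 : ℝ), φ x * Real.exp (-(x * y))) * (y : ℂ) ^ (s - 1)
      = Complex.Gamma s * ∫ x : ℝ in Ioi (1 : ℝ), φ x * (x : ℂ) ^ (-s) := by
  have hs0 : 0 < s.re := by linarith
  have hint := integrableOn_mul_cpow_neg_of_norm_le_rpow hφm hφ hs
  have hprod := integrable_prod_mul_exp_neg_mul_mul_cpow hφm hs0 hint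
  refine ⟨fun y hy => integrableOn_mul_exp_neg_mul_of_norm_le_rpow hA hφm hφ hy, ?_, hint, ?_⟩
  · simpa only [IntegrableOn, Function.uncurry_apply_pair, integral_mul_const] using
      hprod.integral_prod_right
  · simp_rw [← integral_mul_const]
    rw [← integral_integral_swap hprod, ← integral_const_mul]
    refine setIntegral_congr_fun measurableSet_Ioi fun x hx => ?_
    have hx0 : 0 < x := one_pos.trans hx
    have hΓ := integral_cpow_mul_exp_neg_mul_Ioi hs0 hx0
    rw [one_div, inv_cpow _ _ (by simp [arg_ofReal_of_nonneg hx0.le, Real.pi_pos.ne]),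
      ← cpow_neg] at hΓ
    simp only [mul_assoc, integral_const_mul]
    rw [mul_left_comm, mul_comm (Gamma s), ← hΓ]
    congr 2 with y
    push_cast
    ring
end
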